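/- arXiv:2011.05952 — 3 statements merged into one kernel-verified Lean document; each statement's English description precedes it below -/
import Mathlib

section
/- Let n be an odd positive integer and let s be a complex number with Re s > 1. Then Σ_{q=1}^∞ K(n,0;q)/q^{2+s} = σ_{−s}(χ₄;n²) / L(χ₄, 1+s). -/
open Complex Real MeasureTheory Filter Finset

noncomputable section

/-- The nontrivial Dirichlet character mod 4, extended to `ℤ`, valued in `ℂ`. -/
def chi4 (m : ℤ) : ℂ := if m % 4 = 1 then 1 else if m % 4 = 3 then -1 else 0

/-- `σ_s(χ₄; n) = ∑_{d ∣ n} χ₄(d) d^s`. -/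
def sigmaChi4 (s : ℂ) (n : ℕ) : ℂ := ∑ d ∈ n.divisors, chi4 d * (d : ℂ) ^ s

/-- `σ'_s(χ₄; n) = ∑_{d ∣ n} χ₄(d) d^s log d`. -/
def sigmaChi4' (s : ℂ) (n : ℕ) : ℂ := ∑ d ∈ n.divisors, chi4 d * (d : ℂ) ^ s * (Real.log d : ℂ)

/-- `e(x) = exp(2πix)`. -/
def e2pi (x : ℂ) : ℂ := Complex.exp (2 * (Real.pi : ℂ) * Complex.I * x)

/-- The Dirichlet L-function of the nontrivial character mod 4. -/
def Lchi4 (s : ℂ) : ℂ :=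
  DirichletCharacter.LFunction (ZMod.χ₄.ringHomComp (Int.castRingHom ℂ)) s

/-- Generalized quadratic Gauss sum `G(a, n; q)`. -/
def Gsum (a n : ℤ) (q : ℕ) : ℂ :=
  ∑ x ∈ Finset.range q, e2pi (((a * (x : ℤ) ^ 2 + n * (x : ℤ) : ℤ) : ℂ) / (q : ℂ))

/-- `K(n, l; q) = ∑_{a b ≡ 1 (mod q)} G(a,n;q) G(b,l;q)`. -/
def Ksum (n l : ℤ) (q : ℕ) : ℂ :=
  ∑ a ∈ Finset.range q, ∑ b ∈ Finset.range q,
    if (a * b) % q = 1 % q then Gsum a n q * Gsum b l q else 0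

/-- Kloosterman sum `S(m, n; c)`. -/
def kloosterman (m n : ℤ) (c : ℕ) : ℂ :=
  ∑ x ∈ Finset.range c,
    if Nat.gcd x c = 1 then
      e2pi (((m * (x : ℤ) + n * ((((x : ZMod c)⁻¹).val : ℕ) : ℤ) : ℤ) : ℂ) / (c : ℂ))
    else 0

/-- Ramanujan sum `c_C(m)`. -/
def ramanujanSum (C : ℕ) (m : ℤ) : ℂ :=
  ∑ D ∈ Finset.range C,
    if Nat.gcd D C = 1 then e2pi (((m * (D : ℤ) : ℤ) : ℂ) / (C : ℂ)) else 0

/-- Gauss sum `g(χ₄; q; m)`. -/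
def gaussChi4 (q : ℕ) (m : ℤ) : ℂ :=
  ∑ u ∈ Finset.range q,
    if Nat.gcd u q = 1 then chi4 u * e2pi (((m * (u : ℤ) : ℤ) : ℂ) / (q : ℂ)) else 0

end

lemma e2pi_eq (q : ℕ) [NeZero q] (k : ℤ) : e2pi ((k : ℂ) / (q : ℂ)) = ZMod.stdAddChar (k : ZMod q) := by
  rw [ZMod.stdAddChar_coe, e2pi, mul_div_assoc]

lemma sum_range_zmod (q : ℕ) [NeZero q] (f : ZMod q → ℂ) :
    ∑ x ∈ Finset.range q, f (x : ZMod q) = ∑ x : ZMod q, f x := by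
  refine Finset.sum_bij (fun x _ => (x : ZMod q)) (by simp) ?_ ?_ (by simp)
  · intro a ha b hb h
    have := (ZMod.natCast_eq_natCast_iff' _ _ _).1 h
    rwa [Nat.mod_eq_of_lt (by simpa using ha), Nat.mod_eq_of_lt (by simpa using hb)] at this
  · intro b _
    exact ⟨b.val, by simpa using ZMod.val_lt b, by simp⟩

lemma Gsum_eq (q : ℕ) [NeZero q] (a n : ℤ) :
    Gsum a n q = ∑ x : ZMod q, ZMod.stdAddChar ((a : ZMod q) * x ^ 2 + (n : ZMod q) * x) := by
  rw [← sum_range_zmod, Gsum]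
  refine Finset.sum_congr rfl fun x _ => ?_
  rw [e2pi_eq]; push_cast; rfl

lemma chi4_eq (m : ℕ) : chi4 m = ((ZMod.χ₄ (m : ZMod 4) : ℤ) : ℂ) := by
  have h := ZMod.χ₄_nat_eq_if_mod_four m
  rw [h, chi4]
  have : m % 4 < 4 := Nat.mod_lt _ (by norm_num)
  split_ifs <;> first | (exfalso; omega) | simp

lemma Gprime (p : ℕ) [Fact p.Prime] (hp : p ≠ 2) (a : ℤ) (ha : IsCoprime a p) :
    Gsum a 0 p ^ 2 = chi4 p * p := by
  classical
  have hc : ringChar (ZMod p) ≠ 2 := by rwa [ZMod.ringChar_zmod_n]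
  have hu : IsUnit (a : ZMod p) := (ZMod.coe_int_isUnit_iff_isCoprime _ _).2 ha.symm
  obtain ⟨u, hu⟩ := hu
  let χ : MulChar (ZMod p) ℂ := (quadraticChar (ZMod p)).ringHomComp (Int.castRingHom ℂ)
  let ψ : AddChar (ZMod p) ℂ := (ZMod.stdAddChar (N := p)).mulShift a
  have hψ : ψ.IsPrimitive := by
    intro b hb h
    have := ZMod.isPrimitive_stdAddChar p (a := a * b) (by
      rw [← hu]; simpa using hb)
    apply this
    rw [← h]
    simp only [ψ, AddChar.mulShift_mulShift]
  have hχ1 : χ ≠ 1 := (MulChar.ringHomComp_ne_one_iff (RingHom.injective_int _)).mpr (quadraticChar_ne_one hc)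
  have hχ2 : χ.IsQuadratic := (quadraticChar_isQuadratic _).comp _
  have key : Gsum a 0 p = gaussSum χ ψ := by
    rw [Gsum_eq]
    have h0 : ∑ t : ZMod p, ψ t = 0 := AddChar.sum_eq_zero_of_ne_one (by
      have := hψ (a := 1) one_ne_zero
      rwa [AddChar.mulShift_one] at this)
    have : gaussSum χ ψ = ∑ t : ZMod p, (χ t + 1) * ψ t := by
      simp only [add_mul, one_mul, Finset.sum_add_distrib, h0, add_zero, gaussSum]
    rw [this]
    have h1 : ∀ t : ZMod p, (χ t + 1) = ((Finset.univ.filter (fun x : ZMod p => x ^ 2 = t)).card : ℂ) := by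
      intro t
      have := quadraticChar_card_sqrts hc t
      have h3 : (χ t + 1) = ((quadraticChar (ZMod p) t + 1 : ℤ) : ℂ) := by simp [χ]
      rw [h3, ← this]
      simp only [Set.toFinset_ofPred]
      norm_cast
    simp only [h1]
    simp only [Finset.card_eq_sum_ones, Finset.sum_filter, Nat.cast_sum, Finset.sum_mul]
    rw [Finset.sum_comm]
    refine Finset.sum_congr rfl fun x _ => ?_
    simp [ψ, AddChar.mulShift_apply]
  rw [key, gaussSum_sq hχ1 hχ2 hψ, ZMod.card, chi4_eq]
  congr 1
  simp only [χ, MulChar.ringHomComp_apply, quadraticChar_neg_one hc, ZMod.card]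
  simp

lemma sum_range_mul' (A B : ℕ) (f : ℕ → ℂ) :
    ∑ x ∈ Finset.range (A * B), f x = ∑ y ∈ Finset.range A, ∑ z ∈ Finset.range B, f (y + A * z) := by
  rw [Finset.sum_comm]
  induction B with
  | zero => simp
  | succ B ih =>
    rw [Nat.mul_succ, Finset.sum_range_add, ih, Finset.sum_range_succ]
    simp [add_comm]

lemma e2pi_add (x y : ℂ) : e2pi (x + y) = e2pi x * e2pi y := by
  simp [e2pi, mul_add, Complex.exp_add]

lemma e2pi_int (k : ℤ) : e2pi k = 1 := by
  rw [e2pi, Complex.exp_eq_one_iff]; exact ⟨k, by ring⟩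

lemma sum_char (q : ℕ) [NeZero q] (k : ℤ) :
    ∑ z ∈ Finset.range q, e2pi (((k * z : ℤ) : ℂ) / q) = if (q : ℤ) ∣ k then (q : ℂ) else 0 := by
  simp only [e2pi_eq]
  have := AddChar.sum_mulShift (k : ZMod q) (ZMod.isPrimitive_stdAddChar q)
  rw [← sum_range_zmod] at this
  simp only [ZMod.intCast_zmod_eq_zero_iff_dvd, ZMod.card] at this
  push_cast at this ⊢
  simp only [mul_comm (k : ZMod q)]
  rw [this]

lemma G_sq_step (p m : ℕ) (hp : p.Prime) (hp2 : p ≠ 2) (hm : m ≠ 0) (a : ℤ) (ha : IsCoprime a p) :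
    Gsum a 0 (p * p * m) = p * Gsum a 0 m := by
  have hp0 : (p : ℂ) ≠ 0 := by exact_mod_cast hp.ne_zero
  have hm0 : (m : ℂ) ≠ 0 := by exact_mod_cast hm
  have : NeZero p := ⟨hp.ne_zero⟩
  have e : p * p * m = (p * m) * p := by ring
  rw [e, Gsum, sum_range_mul']
  have h1 : ∀ y z : ℕ, e2pi (((a * ((y + p * m * z : ℕ) : ℤ) ^ 2 + 0 * ((y + p * m * z : ℕ) : ℤ) : ℤ) : ℂ) / ((p * m * p : ℕ) : ℂ))
      = e2pi (((a * y ^ 2 : ℤ) : ℂ) / (p * m * p : ℕ)) * e2pi (((2 * a * y * z : ℤ) : ℂ) / p) := by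
    intro y z
    rw [← mul_one (e2pi (((2 * a * y * z : ℤ) : ℂ) / p)), ← e2pi_int (a * m * z ^ 2), ← e2pi_add, ← e2pi_add]
    congr 1
    push_cast
    field_simp
    ring
  simp only [h1, ← Finset.mul_sum, sum_char p]
  have h2 : ∀ y : ℕ, ((p : ℤ) ∣ 2 * a * y ↔ p ∣ y) := by
    intro y
    rw [← Int.natCast_dvd_natCast]
    refine ⟨fun h => ?_, fun h => h.mul_left _⟩
    refine IsCoprime.dvd_of_dvd_mul_left ?_ h
    refine IsCoprime.mul_right ?_ ha.symm
    have := (Nat.coprime_primes hp Nat.prime_two).2 hp2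
    exact_mod_cast this.isCoprime
  simp only [h2]
  rw [sum_range_mul' p m, Finset.sum_eq_single 0]
  · simp only [Gsum, Finset.mul_sum]
    refine Finset.sum_congr rfl fun x _ => ?_
    rw [if_pos (by simp), mul_comm]
    congr 2
    push_cast
    field_simp
    ring
  · intro b hb hb0
    refine Finset.sum_eq_zero fun x _ => ?_
    rw [if_neg, mul_zero]
    rw [← Nat.dvd_add_iff_left (Dvd.intro _ rfl)]
    exact Nat.not_dvd_of_pos_of_lt (Nat.pos_of_ne_zero hb0) (by simpa using hb)
  · intro h; simp [hp.pos] at h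

lemma G_mul (p m : ℕ) (hp : p ≠ 0) (hm : m ≠ 0) (h : Nat.Coprime p m) (a : ℤ) :
    Gsum a 0 (p * m) = Gsum (a * m) 0 p * Gsum (a * p) 0 m := by
  have : NeZero p := ⟨hp⟩
  have : NeZero m := ⟨hm⟩
  have : NeZero (p * m) := ⟨mul_ne_zero hp hm⟩
  have hp0 : (p : ℂ) ≠ 0 := by exact_mod_cast hp
  have hm0 : (m : ℂ) ≠ 0 := by exact_mod_cast hm
  rw [Gsum_eq (p * m)]
  simp only [Gsum, Finset.sum_mul_sum]
  rw [← Finset.sum_product']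
  have hinj : Set.InjOn (fun x : ℕ × ℕ => ((m * x.1 + p * x.2 : ℕ) : ZMod (p * m)))
      (Finset.range p ×ˢ Finset.range m : Finset (ℕ × ℕ)) := by
    rintro ⟨u, v⟩ h1 ⟨u', v'⟩ h2 h3
    simp only [Finset.coe_product, Finset.coe_range, Set.mem_prod, Set.mem_Iio] at h1 h2
    simp only at h3
    rw [ZMod.natCast_eq_natCast_iff] at h3
    have hA : u ≡ u' [MOD p] := by
      have := h3.of_mul_right m
      simp only [Nat.ModEq, Nat.add_mul_mod_self_left] at this
      exact Nat.ModEq.cancel_left_of_coprime h this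
    have hB : v ≡ v' [MOD m] := by
      have := h3.of_mul_left p
      simp only [Nat.ModEq, Nat.mul_add_mod] at this
      exact Nat.ModEq.cancel_left_of_coprime h.symm this
    rw [Nat.ModEq, Nat.mod_eq_of_lt h1.1, Nat.mod_eq_of_lt h2.1] at hA
    rw [Nat.ModEq, Nat.mod_eq_of_lt h1.2, Nat.mod_eq_of_lt h2.2] at hB
    simp [hA, hB]
  have himg : (Finset.range p ×ˢ Finset.range m : Finset (ℕ × ℕ)).image
      (fun x : ℕ × ℕ => ((m * x.1 + p * x.2 : ℕ) : ZMod (p * m))) = Finset.univ := by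
    apply Finset.eq_univ_of_card
    rw [Finset.card_image_of_injOn hinj, ZMod.card]
    simp
  rw [← himg, Finset.sum_image hinj]
  refine Finset.sum_congr rfl ?_
  · rintro ⟨u, v⟩ _
    have : ((a : ZMod (p * m)) * ((m * u + p * v : ℕ) : ZMod (p * m)) ^ 2 + ((0 : ℤ) : ZMod (p * m)) * ((m * u + p * v : ℕ) : ZMod (p * m)))
      = ((a * (m * u + p * v : ℕ) ^ 2 : ℤ) : ZMod (p * m)) := by push_cast; ring
    rw [this, ← e2pi_eq, ← e2pi_add, ← mul_one (e2pi (_ + _)), ← e2pi_int (2 * a * u * v), ← e2pi_add]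
    congr 1
    push_cast
    field_simp
    ring

lemma chi4_mul (a b : ℕ) : chi4 (a * b : ℕ) = chi4 a * chi4 b := by
  simp only [chi4_eq]
  rw [Nat.cast_mul, map_mul, Int.cast_mul]

lemma chi4_sq (a : ℕ) (h : Odd a) : chi4 a * chi4 a = 1 := by
  have h1 := Nat.odd_iff.1 h
  rw [chi4]
  split_ifs
  · simp
  · simp
  · exfalso; omega

lemma G_sq (q : ℕ) : Odd q → ∀ a : ℤ, IsCoprime a q → Gsum a 0 q ^ 2 = chi4 q * q := by
  induction q using Nat.strong_induction_on with
  | _ q ih =>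
  intro hq a ha
  have hq0 : q ≠ 0 := by rintro rfl; simp at hq
  by_cases hq1 : q = 1
  · subst hq1; simp [Gsum, chi4, e2pi]
  have hp := Nat.minFac_prime hq1
  obtain ⟨m, hm⟩ := Nat.minFac_dvd q
  generalize hpp : q.minFac = p at *
  subst hm
  have hm0 : m ≠ 0 := by rintro rfl; simp at hq0
  have hpo : Odd p := (Nat.odd_mul.1 hq).1
  have hmo : Odd m := (Nat.odd_mul.1 hq).2
  have hp2 : p ≠ 2 := by rintro rfl; revert hpo; decide
  have hap : IsCoprime a p := by
    push_cast at ha; exact ha.of_mul_right_left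
  have ham : IsCoprime a m := by
    push_cast at ha; exact ha.of_mul_right_right
  have hmlt : m < p * m := by nlinarith [hp.two_le, Nat.pos_of_ne_zero hm0]
  have : Fact p.Prime := ⟨hp⟩
  by_cases hd : p ∣ m
  · obtain ⟨k, rfl⟩ := hd
    have hk0 : k ≠ 0 := by rintro rfl; simp at hm0
    rw [← mul_assoc, G_sq_step p k hp hp2 hk0 a hap, mul_pow, ih k _ (Nat.odd_mul.1 hmo).2 a,
      mul_assoc p p k, chi4_mul, chi4_mul, ← mul_assoc (chi4 p), chi4_sq p hpo]
    · push_cast; ring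
    · push_cast at ham; exact ham.of_mul_right_right
    · nlinarith [hp.two_le, Nat.pos_of_ne_zero hk0]
  · have hc : Nat.Coprime p m := (Nat.Prime.coprime_iff_not_dvd hp).2 hd
    have hci : IsCoprime (p : ℤ) m := by exact_mod_cast hc.isCoprime
    rw [G_mul p m hp.ne_zero hm0 hc, mul_pow, Gprime p hp2 _ (hap.mul_left hci.symm),
      ih m hmlt hmo _ (ham.mul_left hci), chi4_mul]
    push_cast; ring

noncomputable def Gz (q : ℕ) [NeZero q] (a n : ZMod q) : ℂ := ∑ x : ZMod q, ZMod.stdAddChar (a * x ^ 2 + n * x)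

lemma Ksum_eq (q : ℕ) [NeZero q] (n : ℤ) :
    Ksum n 0 q = ∑ u : (ZMod q)ˣ, Gz q u n * Gz q (u⁻¹ : (ZMod q)ˣ) 0 := by
  classical
  have h1 : Ksum n 0 q = ∑ a : ZMod q, ∑ b : ZMod q, if a * b = 1 then Gz q a n * Gz q b 0 else 0 := by
    rw [← sum_range_zmod q (fun a => ∑ b : ZMod q, if a * b = 1 then Gz q a n * Gz q b 0 else 0)]
    refine Finset.sum_congr rfl fun a _ => ?_
    rw [← sum_range_zmod q (fun b => if (a : ZMod q) * b = 1 then Gz q a n * Gz q b 0 else 0)]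
    refine Finset.sum_congr rfl fun b _ => ?_
    have : (a * b % q = 1 % q) ↔ ((a : ZMod q) * b = 1) := by
      have := ZMod.natCast_eq_natCast_iff' (a * b) 1 q
      rw [← this]; push_cast; rfl
    simp only [this, Gsum_eq, Gz]
    push_cast
    rfl
  rw [h1, ← Finset.sum_product', ← Finset.sum_filter]
  symm
  refine Finset.sum_bij (fun u _ => ((u : ZMod q), ((u⁻¹ : (ZMod q)ˣ) : ZMod q))) (by simp) ?_ ?_ (by simp)
  · intro u _ v _ h
    exact Units.ext (Prod.ext_iff.1 h).1
  · rintro ⟨a, b⟩ h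
    simp only [Finset.mem_filter] at h
    refine ⟨⟨a, b, h.2, by rw [mul_comm]; exact h.2⟩, by simp, rfl⟩

lemma Gz_zero (q : ℕ) [NeZero q] (a n h : ZMod q) (h2 : 2 * h = 0) (h3 : a * h ^ 2 + n * h ≠ 0) :
    Gz q a n = 0 := by
  have h4 : Gz q a n = ZMod.stdAddChar (a * h ^ 2 + n * h) * Gz q a n := by
    conv_lhs => rw [Gz, ← Equiv.sum_comp (Equiv.addRight h)]
    rw [Gz, Finset.mul_sum]
    refine Finset.sum_congr rfl fun x _ => ?_
    rw [← AddChar.map_add_eq_mul]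
    congr 1
    simp only [Equiv.coe_addRight]
    linear_combination a * x * h2
  by_contra h5
  have h6 : ZMod.stdAddChar (a * h ^ 2 + n * h) = 1 := by
    have : (ZMod.stdAddChar (a * h ^ 2 + n * h) - 1) * Gz q a n = 0 := by
      rw [sub_mul, ← h4]; ring
    exact sub_eq_zero.1 ((mul_eq_zero.1 this).resolve_right h5)
  rw [← (ZMod.stdAddChar (N := q)).map_zero_eq_one] at h6
  exact h3 (ZMod.injective_stdAddChar h6)

lemma Ksum_even (q : ℕ) [NeZero q] (n : ℤ) (hn : Odd n) (hq : Even q) : Ksum n 0 q = 0 := by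
  rw [Ksum_eq]
  refine Finset.sum_eq_zero fun u _ => ?_
  obtain ⟨m, rfl⟩ := hq
  have hm0 : m ≠ 0 := by
    have := NeZero.ne (m + m); omega
  have h2 : 2 * (m : ZMod (m + m)) = 0 := by
    have := ZMod.natCast_self (m + m)
    push_cast at this
    rw [← this]; ring
  rcases Nat.even_or_odd m with hm | hm
  · rw [Gz_zero _ _ _ (m : ZMod (m + m)) h2, zero_mul]
    obtain ⟨k, hk⟩ := hm
    have h3 : (m : ZMod (m + m)) ^ 2 = 0 := by
      have : (m : ZMod (m + m)) = 2 * (k : ZMod (m + m)) := by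
        rw [two_mul]; exact_mod_cast congrArg (Nat.cast (R := ZMod (m + m))) hk
      rw [sq]; nth_rw 2 [this]
      linear_combination (k : ZMod (m + m)) * h2
    rw [h3, mul_zero, zero_add]
    intro h4
    have h5 : ((n * m : ℤ) : ZMod (m + m)) = 0 := by push_cast; exact h4
    rw [ZMod.intCast_zmod_eq_zero_iff_dvd] at h5
    obtain ⟨c, hc⟩ := h5
    obtain ⟨d, hd⟩ := hn
    push_cast at hc
    have : n = 2 * c := by
      have hm' : (m : ℤ) ≠ 0 := by exact_mod_cast hm0
      apply mul_right_cancel₀ hm'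
      rw [hc]; ring
    omega
  · rw [Gz_zero _ ((u⁻¹ : (ZMod (m + m))ˣ) : ZMod (m + m)) 0 (m : ZMod (m + m)) h2, mul_zero]
    rw [zero_mul, add_zero, Ne, Units.mul_right_eq_zero]
    intro h4
    have h5 : ((m ^ 2 : ℕ) : ZMod (m + m)) = 0 := by push_cast; exact h4
    rw [ZMod.natCast_eq_zero_iff] at h5
    have h6 : 2 ∣ m ^ 2 := (Dvd.intro m (by ring)).trans h5
    have := Nat.prime_two.dvd_of_dvd_pow h6
    have := Nat.odd_iff.1 hm
    omega

lemma Gz_sq (q : ℕ) [NeZero q] (hq : Odd q) (u : (ZMod q)ˣ) : Gz q u 0 ^ 2 = chi4 q * q := by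
  have h := G_sq q hq ((u : ZMod q).val : ℤ) (by
    have := ZMod.val_coe_unit_coprime u
    exact_mod_cast this.isCoprime)
  rw [Gsum_eq] at h
  rw [← h, Gz]
  simp

lemma Ksum_odd (q : ℕ) [NeZero q] (hq : Odd q) (n : ℤ) :
    Ksum n 0 q = chi4 q * q * ∑ u : (ZMod q)ˣ, ZMod.stdAddChar ((u : ZMod q) * (n : ZMod q) ^ 2) := by
  rw [Ksum_eq]
  let t : (ZMod q)ˣ := ZMod.unitOfCoprime 2 (by
    exact (Nat.coprime_two_left).2 hq)
  have ht : (t : ZMod q) = 2 := by simp [t]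
  have ht1 : (2 : ZMod q) * ((t⁻¹ : (ZMod q)ˣ) : ZMod q) = 1 := by rw [← ht]; simp
  have key : ∀ u : (ZMod q)ˣ, Gz q u n * Gz q (u⁻¹ : (ZMod q)ˣ) 0 =
      chi4 q * q * ZMod.stdAddChar (((-(t⁻¹ * t⁻¹) * u⁻¹ : (ZMod q)ˣ) : ZMod q) * (n : ZMod q) ^ 2) := by
    intro u
    have hu : (u : ZMod q) * ((u⁻¹ : (ZMod q)ˣ) : ZMod q) = 1 := by simp
    have e1 : Gz q (u⁻¹ : (ZMod q)ˣ) 0 = Gz q u 0 := by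
      rw [Gz, ← Equiv.sum_comp (Units.mulLeft u), Gz]
      refine Finset.sum_congr rfl fun x _ => ?_
      congr 1
      simp only [Units.mulLeft_apply]
      linear_combination (u : ZMod q) * x ^ 2 * hu
    have e2 : Gz q u n = Gz q u 0 *
        ZMod.stdAddChar (((-(t⁻¹ * t⁻¹) * u⁻¹ : (ZMod q)ˣ) : ZMod q) * (n : ZMod q) ^ 2) := by
      conv_rhs => rw [Gz, ← Equiv.sum_comp (Equiv.addRight
        (((t⁻¹ : (ZMod q)ˣ) : ZMod q) * ((u⁻¹ : (ZMod q)ˣ) : ZMod q) * (n : ZMod q)))]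
      rw [Gz, Finset.sum_mul]
      refine Finset.sum_congr rfl fun x _ => ?_
      rw [← AddChar.map_add_eq_mul]
      congr 1
      simp only [Equiv.coe_addRight]
      push_cast
      generalize ((t⁻¹ : (ZMod q)ˣ) : ZMod q) = T at *
      generalize ((u⁻¹ : (ZMod q)ˣ) : ZMod q) = U at *
      linear_combination (-(n : ZMod q) * x) * ht1 + (-(n : ZMod q) * x * 2 * T - T ^ 2 * U * (n : ZMod q) ^ 2) * hu
    rw [e1, e2, ← Gz_sq q hq u]
    ring
  simp only [key, ← Finset.mul_sum]
  congr 1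
  exact Equiv.sum_comp ((Equiv.inv (ZMod q)ˣ).trans (Equiv.mulLeft (-(t⁻¹ * t⁻¹))))
    (fun v : (ZMod q)ˣ => ZMod.stdAddChar ((v : ZMod q) * (n : ZMod q) ^ 2))

noncomputable def cR (N d : ℕ) : ℂ := ∑ ζ ∈ primitiveRoots d ℂ, ζ ^ N

lemma cR_eq (N q : ℕ) [NeZero q] :
    ∑ u : (ZMod q)ˣ, ZMod.stdAddChar ((u : ZMod q) * (N : ZMod q)) = cR N q := by
  rw [cR]
  have hq : q ≠ 0 := NeZero.ne q
  refine Finset.sum_bij (fun u _ => ZMod.stdAddChar (u : ZMod q)) ?_ ?_ ?_ ?_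
  · intro u _
    rw [mem_primitiveRoots (Nat.pos_of_ne_zero hq), Complex.isPrimitiveRoot_iff _ _ hq]
    refine ⟨(u : ZMod q).val, ZMod.val_lt _, ZMod.val_coe_unit_coprime u, ?_⟩
    have := ZMod.stdAddChar_coe (N := q) ((u : ZMod q).val : ℤ)
    rw [Int.cast_natCast, Int.cast_natCast, ZMod.natCast_zmod_val] at this
    rw [this, mul_div_assoc]
  · intro u _ v _ h
    exact Units.ext (ZMod.injective_stdAddChar h)
  · intro z hz
    rw [mem_primitiveRoots (Nat.pos_of_ne_zero hq), Complex.isPrimitiveRoot_iff _ _ hq] at hz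
    obtain ⟨i, _, hi, rfl⟩ := hz
    refine ⟨ZMod.unitOfCoprime i hi, by simp, ?_⟩
    have := ZMod.stdAddChar_coe (N := q) (i : ℤ)
    simp only [Int.cast_natCast] at this
    rw [ZMod.coe_unitOfCoprime, this, mul_div_assoc]
  · intro u _
    rw [mul_comm, ← nsmul_eq_mul, AddChar.map_nsmul_eq_pow]

lemma sum_nthRoots (N q : ℕ) (hq : q ≠ 0) :
    ∑ ζ ∈ Polynomial.nthRootsFinset q (1 : ℂ), ζ ^ N = if q ∣ N then (q : ℂ) else 0 := by
  have hz := Complex.isPrimitiveRoot_exp q hq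
  set z := Complex.exp (2 * π * I / q) with hzdef
  split_ifs with h
  · have : ∀ ζ ∈ Polynomial.nthRootsFinset q (1 : ℂ), ζ ^ N = 1 := by
      intro ζ hζ
      rw [Polynomial.mem_nthRootsFinset (Nat.pos_of_ne_zero hq)] at hζ
      obtain ⟨k, rfl⟩ := h
      rw [pow_mul, hζ, one_pow]
    rw [Finset.sum_congr rfl this]
    simp [hz.card_nthRootsFinset]
  · have h1 : ∑ ζ ∈ Polynomial.nthRootsFinset q (1 : ℂ), ζ ^ N =
        z ^ N * ∑ ζ ∈ Polynomial.nthRootsFinset q (1 : ℂ), ζ ^ N := by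
      rw [Finset.mul_sum]
      symm
      refine Finset.sum_bij (fun ζ _ => z * ζ) ?_ ?_ ?_ ?_
      · intro ζ hζ
        rw [Polynomial.mem_nthRootsFinset (Nat.pos_of_ne_zero hq)] at hζ ⊢
        rw [mul_pow, hζ, hz.pow_eq_one, mul_one]
      · intro a _ b _ hab
        exact mul_left_cancel₀ (hz.ne_zero hq) hab
      · intro b hb
        rw [Polynomial.mem_nthRootsFinset (Nat.pos_of_ne_zero hq)] at hb
        refine ⟨z⁻¹ * b, ?_, ?_⟩
        · rw [Polynomial.mem_nthRootsFinset (Nat.pos_of_ne_zero hq), mul_pow, hb, inv_pow,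
            hz.pow_eq_one]; simp
        · rw [mul_inv_cancel_left₀ (hz.ne_zero hq)]
      · intro a _
        rw [mul_pow]
    have h2 : z ^ N ≠ 1 := fun h' => h (hz.dvd_of_pow_eq_one _ h')
    by_contra h3
    apply h2
    exact (mul_left_eq_self₀.1 h1.symm).resolve_right h3

lemma sum_cR (N q : ℕ) (hq : q ≠ 0) : ∑ d ∈ q.divisors, cR N d = if q ∣ N then (q : ℂ) else 0 := by
  classical
  rw [← sum_nthRoots N q hq, IsPrimitiveRoot.nthRoots_one_eq_biUnion_primitiveRoots, Finset.sum_biUnion]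
  · rfl
  · intro i _ j _ hij
    exact IsPrimitiveRoot.disjoint hij

lemma norm_cR (N q : ℕ) (hq : q ≠ 0) : ‖cR N q‖ ≤ q := by
  rw [cR]
  refine (norm_sum_le _ _).trans ?_
  have : ∀ ζ ∈ primitiveRoots q ℂ, ‖ζ ^ N‖ ≤ 1 := by
    intro ζ hζ
    have := (isPrimitiveRoot_of_mem_primitiveRoots hζ).norm'_eq_one hq
    simp [this]
  refine (Finset.sum_le_sum this).trans ?_
  rw [Finset.sum_const, Complex.card_primitiveRoots]
  simp only [nsmul_eq_mul, mul_one]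
  exact_mod_cast Nat.totient_le q

lemma Ksum_all (q : ℕ) (hq : q ≠ 0) (n : ℕ) (hn : Odd n) :
    Ksum n 0 q = chi4 q * q * cR (n ^ 2) q := by
  have : NeZero q := ⟨hq⟩
  rcases Nat.even_or_odd q with h | h
  · rw [Ksum_even q n (by exact_mod_cast hn) h]
    have : chi4 q = 0 := by
      have := Nat.even_iff.1 h
      rw [chi4, if_neg (by omega), if_neg (by omega)]
    rw [this]; simp
  · rw [Ksum_odd q h, ← cR_eq]
    push_cast
    rfl

/-- the diagonal term for odd `n`. -/
theorem tsum_Ksum_odd (n : ℕ) (hn : 0 < n) (hno : Odd n) (s : ℂ) (hs : 1 < s.re) :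
    ∑' q : ℕ+, Ksum (n : ℤ) 0 (q : ℕ) / ((q : ℕ) : ℂ) ^ ((2 : ℂ) + s) =
      sigmaChi4 (-s) (n ^ 2) / Lchi4 (1 + s) := by
  let χ : DirichletCharacter ℂ 4 := ZMod.χ₄.ringHomComp (Int.castRingHom ℂ)
  have hχ : ∀ m : ℕ, χ (m : ZMod 4) = chi4 m := by
    intro m; rw [chi4_eq]; simp [χ, MulChar.ringHomComp_apply]
  have hre : 1 < (1 + s).re := by simp; linarith
  have hL : Lchi4 (1 + s) = LSeries (fun m => χ m) (1 + s) := DirichletCharacter.LFunction_eq_LSeries χ hre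
  have hL0 : LSeries (fun m => χ m) (1 + s) ≠ 0 := DirichletCharacter.LSeries_ne_zero_of_one_lt_re χ hre
  rw [hL, eq_div_iff hL0]
  have hsum : LSeriesSummable (cR (n ^ 2)) (1 + s) := by
    refine LSeriesSummable_of_le_const_mul_rpow (x := 2) (by simp; linarith) ⟨1, fun m hm => ?_⟩
    have := norm_cR (n ^ 2) m hm
    norm_num
    exact this
  have hsum2 : LSeriesSummable ((fun m : ℕ => χ m) * cR (n ^ 2)) (1 + s) :=
    DirichletCharacter.LSeriesSummable_mul χ hsum
  have hsum3 : LSeriesSummable (fun m : ℕ => χ m) (1 + s) :=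
    DirichletCharacter.LSeriesSummable_of_one_lt_re χ hre
  have e1 : ∑' q : ℕ+, Ksum (n : ℤ) 0 (q : ℕ) / ((q : ℕ) : ℂ) ^ ((2 : ℂ) + s) =
      LSeries ((fun m : ℕ => χ m) * cR (n ^ 2)) (1 + s) := by
    have hS : Summable (LSeries.term ((fun m : ℕ => χ m) * cR (n ^ 2)) (1 + s)) := hsum2
    rw [LSeries, ← tsum_zero_pnat_eq_tsum_nat hS, LSeries.term_zero, zero_add]
    refine tsum_congr fun q => ?_
    have hq : (q : ℕ) ≠ 0 := q.ne_zero
    have hq' : ((q : ℕ) : ℂ) ≠ 0 := by exact_mod_cast hq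
    rw [LSeries.term_of_ne_zero hq, Ksum_all _ hq n hno, Pi.mul_apply, hχ,
      show (2 : ℂ) + s = 1 + (1 + s) by ring, Complex.cpow_add _ _ hq', Complex.cpow_one]
    field_simp
  have e2 : LSeries.convolution ((fun m : ℕ => χ m) * cR (n ^ 2)) (fun m : ℕ => χ m) =
      (fun m : ℕ => χ m * if m ∈ (n ^ 2).divisors then (m : ℂ) else 0) := by
    have := DirichletCharacter.mul_convolution_distrib χ (cR (n ^ 2)) 1
    rw [mul_one] at this
    rw [this]
    funext m
    rw [Pi.mul_apply]
    congr 1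
    rw [LSeries.convolution_def]
    simp only [Pi.one_apply, mul_one]
    by_cases hm : m = 0
    · subst hm; simp
    · rw [Nat.sum_divisorsAntidiagonal (fun i _ => cR (n ^ 2) i), sum_cR _ _ hm]
      simp [Nat.mem_divisors, hn.ne']
  rw [e1, ← LSeries_convolution' hsum2 hsum3, e2, LSeries, tsum_eq_sum (s := (n ^ 2).divisors), sigmaChi4]
  · refine Finset.sum_congr rfl fun d hd => ?_
    have hd0 : d ≠ 0 := (Nat.pos_of_mem_divisors hd).ne'
    have hd' : (d : ℂ) ≠ 0 := by exact_mod_cast hd0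
    rw [LSeries.term_of_ne_zero hd0, if_pos hd, hχ, Complex.cpow_add _ _ hd', Complex.cpow_one,
      Complex.cpow_neg]
    field_simp
  · intro m hm
    rw [LSeries.term_def]
    simp [hm]
end

section
/- Let m be a positive integer and s a complex number with Re s > 1/2. Then Σ_{C=1}^∞ χ₄(C)·c_C(m)/C^{2s} = σ_{1−2s}(χ₄; m) / L(χ₄, 2s), where c_C(m) := Σ_{D mod C, gcd(D,C)=1} e(m·D/C) denotes the Ramanujan sum. -/
open Complex Real MeasureTheory Filter Finset

lemma chi4_eq_s13 (n : ℕ) :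
    chi4 (n : ℤ) = (ZMod.χ₄.ringHomComp (Int.castRingHom ℂ) : DirichletCharacter ℂ 4) (n : ZMod 4) := by
  rw [MulChar.ringHomComp_apply, ZMod.χ₄_nat_eq_if_mod_four]
  unfold chi4
  have h : n % 4 < 4 := Nat.mod_lt _ (by norm_num)
  have h1 : ((n : ℤ) % 4) = ((n % 4 : ℕ) : ℤ) := by norm_num
  have h2 : n % 2 = (n % 4) % 2 := by omega
  rw [h1, h2]
  interval_cases (n % 4) <;> simp

lemma e2pi_sum (m n : ℕ) (hn : 0 < n) :
    ∑ D ∈ Finset.range n, e2pi (((((m : ℤ) * (D : ℤ) : ℤ)) : ℂ) / (n : ℂ))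
      = if n ∣ m then (n : ℂ) else 0 := by
  have hn0 : (n : ℂ) ≠ 0 := by exact_mod_cast hn.ne'
  have hz := Complex.isPrimitiveRoot_exp n hn.ne'
  set z := Complex.exp (2 * π * I / n) with hzdef
  have h1 : ∀ D ∈ Finset.range n, e2pi (((((m : ℤ) * (D : ℤ) : ℤ)) : ℂ) / (n : ℂ)) = (z ^ m) ^ D := by
    intro D _
    rw [← pow_mul, hzdef, ← Complex.exp_nat_mul]
    unfold e2pi
    congr 1
    push_cast
    ring
  rw [Finset.sum_congr rfl h1]
  split_ifs with h
  · rw [(hz.pow_eq_one_iff_dvd m).2 h]; simp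
  · have hne : z ^ m ≠ 1 := fun h' => h ((hz.pow_eq_one_iff_dvd m).1 h')
    rw [geom_sum_eq hne, ← pow_mul, mul_comm, pow_mul, hz.pow_eq_one]
    simp

lemma ram_div_sum (m n : ℕ) (hn : 0 < n) :
    ∑ d ∈ n.divisors, ramanujanSum d (m : ℤ) = if n ∣ m then (n : ℂ) else 0 := by
  rw [← e2pi_sum m n hn]
  unfold ramanujanSum
  simp_rw [← Finset.sum_filter]
  rw [Finset.sum_sigma']
  refine Finset.sum_bij (fun p _ => p.2 * (n / p.1)) ?_ ?_ ?_ ?_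
  · rintro ⟨d, x⟩ h
    simp only [Finset.mem_sigma, Nat.mem_divisors, Finset.mem_filter, Finset.mem_range] at h ⊢
    obtain ⟨⟨⟨k, rfl⟩, _⟩, hx, hg⟩ := h
    have hd : 0 < d := by omega
    have hk : 0 < k := Nat.pos_of_mul_pos_left hn
    rw [Nat.mul_div_cancel_left _ hd]
    exact Nat.mul_lt_mul_of_pos_right hx hk
  · rintro ⟨d, x⟩ h ⟨d', x'⟩ h' heq
    simp only [Finset.mem_sigma, Nat.mem_divisors, Finset.mem_filter, Finset.mem_range] at h h' heq
    obtain ⟨⟨hd, _⟩, hx, hg⟩ := h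
    obtain ⟨⟨hd', _⟩, hx', hg'⟩ := h'
    have e1 : Nat.gcd (x * (n / d)) n = n / d := by
      conv_lhs => rw [← Nat.mul_div_cancel' hd]
      rw [Nat.mul_div_cancel' hd]
      nth_rewrite 2 [← Nat.mul_div_cancel' hd]
      rw [Nat.gcd_mul_right, hg, one_mul]
    have e2 : Nat.gcd (x' * (n / d')) n = n / d' := by
      nth_rewrite 2 [← Nat.mul_div_cancel' hd']
      rw [Nat.gcd_mul_right, hg', one_mul]
    have e3 : n / d = n / d' := by rw [← e1, ← e2, heq]
    have hdd : d = d' := by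
      rw [← Nat.div_div_self hd hn.ne', e3, Nat.div_div_self hd' hn.ne']
    subst hdd
    have hpos : 0 < n / d := Nat.div_pos (Nat.le_of_dvd hn hd) (by omega)
    have := Nat.eq_of_mul_eq_mul_right hpos heq
    subst this
    rfl
  · intro D hD
    rw [Finset.mem_range] at hD
    have hg : 0 < Nat.gcd D n := Nat.gcd_pos_of_pos_right _ hn
    refine ⟨⟨n / Nat.gcd D n, D / Nat.gcd D n⟩, ?_, ?_⟩
    · simp only [Finset.mem_sigma, Nat.mem_divisors, Finset.mem_filter, Finset.mem_range]
      refine ⟨⟨Nat.div_dvd_of_dvd (Nat.gcd_dvd_right _ _), hn.ne'⟩, ?_, Nat.coprime_div_gcd_div_gcd hg⟩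
      exact Nat.div_lt_div_of_lt_of_dvd (Nat.gcd_dvd_right _ _) hD
    · simp only
      rw [Nat.div_div_self (Nat.gcd_dvd_right _ _) hn.ne', Nat.div_mul_cancel (Nat.gcd_dvd_left _ _)]
  · rintro ⟨d, x⟩ h
    simp only [Finset.mem_sigma, Nat.mem_divisors, Finset.mem_filter, Finset.mem_range] at h ⊢
    obtain ⟨⟨⟨k, rfl⟩, _⟩, hx, hg⟩ := h
    have hd : 0 < d := by omega
    have hk : 0 < k := Nat.pos_of_mul_pos_left hn
    rw [Nat.mul_div_cancel_left _ hd]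
    have hd0 : (d : ℂ) ≠ 0 := by exact_mod_cast hd.ne'
    have hk0 : (k : ℂ) ≠ 0 := by exact_mod_cast hk.ne'
    congr 1
    push_cast
    field_simp

open scoped LSeries.notation ArithmeticFunction.Moebius in
/-- Dirichlet series of twisted Ramanujan sums. -/
theorem tsum_chi4_ramanujan (m : ℕ) (hm : 0 < m) (s : ℂ) (hs : 1 / 2 < s.re) :
    ∑' C : ℕ+, chi4 ((C : ℕ) : ℤ) * ramanujanSum (C : ℕ) (m : ℤ) / ((C : ℕ) : ℂ) ^ (2 * s) =
      sigmaChi4 (1 - 2 * s) m / Lchi4 (2 * s) := by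
  have hw : 1 < (2 * s).re := by
    have : (2 * s).re = 2 * s.re := by simp
    linarith
  set w := 2 * s with hwdef
  let χ : DirichletCharacter ℂ 4 := ZMod.χ₄.ringHomComp (Int.castRingHom ℂ)
  let g : ℕ → ℂ := fun n => if n ∣ m then (n : ℂ) else 0
  let f1 : ℕ → ℂ := (fun n : ℕ => χ (n : ZMod 4)) * (fun n : ℕ => ((μ n : ℤ) : ℂ))
  let f2 : ℕ → ℂ := fun n => χ (n : ZMod 4) * g n
  have hsum1 : LSeriesSummable f1 w :=
    DirichletCharacter.LSeriesSummable_mul χ (ArithmeticFunction.LSeriesSummable_moebius_iff.mpr hw)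
  have hzero : ∀ n ∉ m.divisors, LSeries.term f2 w n = 0 := by
    intro n hn
    have : ¬ n ∣ m := fun h => hn (Nat.mem_divisors.2 ⟨h, hm.ne'⟩)
    rw [LSeries.term_def]
    simp [f2, g, this]
  have hsum2 : LSeriesSummable f2 w := summable_of_ne_finset_zero hzero
  have hL2 : LSeries f2 w = sigmaChi4 (1 - w) m := by
    rw [LSeries, tsum_eq_sum hzero, sigmaChi4]
    refine Finset.sum_congr rfl fun d hd => ?_
    have hd0 : d ≠ 0 := (Nat.pos_of_mem_divisors hd).ne'
    have hdc : (d : ℂ) ≠ 0 := by exact_mod_cast hd0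
    rw [LSeries.term_of_ne_zero hd0, chi4_eq_s13, Complex.cpow_sub _ _ hdc, Complex.cpow_one]
    simp only [f2, g, Nat.dvd_of_mem_divisors hd, if_true]
    exact mul_div_assoc _ _ _
  have hmob := (ArithmeticFunction.sum_eq_iff_sum_mul_moebius_eq (f := fun d => ramanujanSum d (m : ℤ))
    (g := g)).1 (fun n hn => ram_div_sum m n hn)
  have hL : LSeries (f1 ⍟ f2) w = ∑' C : ℕ+, chi4 ((C : ℕ) : ℤ) * ramanujanSum (C : ℕ) (m : ℤ) / ((C : ℕ) : ℂ) ^ w := by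
    rw [LSeries, ← PNat.coe_injective.tsum_eq]
    · refine tsum_congr fun C => ?_
      rw [LSeries.term_of_ne_zero C.ne_zero, chi4_eq_s13, ← hmob _ C.pos, LSeries.convolution_def,
        Finset.mul_sum]
      congr 1
      refine Finset.sum_congr rfl fun p hp => ?_
      rw [← (Nat.mem_divisorsAntidiagonal.1 hp).1]
      simp only [f1, f2, Pi.mul_apply, Nat.cast_mul, map_mul]
      change _ = χ _ * χ _ * _
      ring
    · intro n hn
      have : n ≠ 0 := by
        rintro rfl
        simp at hn
      exact ⟨⟨n, Nat.pos_of_ne_zero this⟩, rfl⟩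
  rw [← hL, LSeries_convolution' hsum1 hsum2, hL2]
  have hone := DirichletCharacter.LSeries.mul_mu_eq_one χ hw
  have hne := DirichletCharacter.LSeries_ne_zero_of_one_lt_re χ hw
  have hLf : Lchi4 w = LSeries (fun n : ℕ => χ (n : ZMod 4)) w :=
    DirichletCharacter.LFunction_eq_LSeries χ hw
  rw [hLf, eq_div_iff hne]
  have : LSeries (fun n : ℕ => χ (n : ZMod 4)) w * LSeries f1 w = 1 := hone
  linear_combination sigmaChi4 (1 - w) m * this
end

section
/- Let N = 16 or N = 64 and let A, B, C, D be integers with A·D − B·C = 1. Then: (i) if C ≡ −2A (mod N), then C is even and χ₄(2B + D) = χ₄(−C/2); (ii) if D ≡ −2B (mod N), then D is even and χ₄(2A + C) = χ₄(D/2). -/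
open Complex Real MeasureTheory Filter Finset

theorem chi4_aux_eq (x y k : ℤ) (h : x * y = 1 + 4 * k) : x % 4 = y % 4 := by
  have h1 : (x * y) % 4 = 1 := by omega
  rw [Int.mul_emod] at h1
  have hx : x % 4 = 0 ∨ x % 4 = 1 ∨ x % 4 = 2 ∨ x % 4 = 3 := by omega
  have hy : y % 4 = 0 ∨ y % 4 = 1 ∨ y % 4 = 2 ∨ y % 4 = 3 := by omega
  rcases hx with hx | hx | hx | hx <;> rcases hy with hy | hy | hy | hy <;>
    rw [hx, hy] at h1 ⊢ <;> norm_num at h1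

theorem chi4_aux_congr (x y : ℤ) (h : x % 4 = y % 4) : chi4 x = chi4 y := by
  unfold chi4
  rw [h]

/-- character identities for unimodular integer quadruples, levels 16 and 64. -/
theorem chi4_coset_identities_higher (N : ℤ) (hN : N = 16 ∨ N = 64) (A B C D : ℤ)
    (h : A * D - B * C = 1) :
    (C ≡ -2 * A [ZMOD N] → Even C ∧ chi4 (2 * B + D) = chi4 (-(C / 2))) ∧
    (D ≡ -2 * B [ZMOD N] → Even D ∧ chi4 (2 * A + C) = chi4 (D / 2)) := by
  have key : ∀ x y : ℤ, x ≡ y [ZMOD N] → ∃ k, x = y + 16 * k := by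
    intro x y hxy
    obtain ⟨k, hk⟩ := hxy.symm.dvd
    rcases hN with rfl | rfl
    · exact ⟨k, by linarith⟩
    · exact ⟨4 * k, by linarith⟩
  constructor
  · intro hc
    obtain ⟨k, rfl⟩ := key _ _ hc
    refine ⟨⟨-A + 8 * k, by ring⟩, chi4_aux_congr _ _ ?_⟩
    have := chi4_aux_eq (2 * B + D) A (4 * k * B) (by linarith)
    omega
  · intro hc
    obtain ⟨k, rfl⟩ := key _ _ hc
    refine ⟨⟨-B + 8 * k, by ring⟩, chi4_aux_congr _ _ ?_⟩
    have := chi4_aux_eq (2 * A + C) (-B) (-4 * k * A) (by linarith)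
    omega
end
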